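/- arXiv:math/0501035 — 7 statements merged into one kernel-verified Lean document; each statement's English description precedes it below -/
import Mathlib

section
/- Let V(x) = min_{1≤i≤J} b_i·(z−x) for x in the closure of G. Then V is Lipschitz continuous, V(x) = 0 for every x ∈ ∂_oG, and V is a viscosity solution of the PDE H(DV)=0 with the stated boundary conditions; namely: (i) for every x ∈ G and every p ∈ D^+V(x), either H(p) ≥ 0 or there exists i ∈ I(x) with p·γ_i ≥ 0; and (ii) for every x ∈ G \ ∂_cG and every p ∈ D^−V(x), either H(p) ≤ 0 or there exists i ∈ I(x) with p·γ_i ≤ 0. -/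
open Real

noncomputable section

/-- Euclidean dot product on `ℝ^J`. -/
def dotJ {J : ℕ} (p q : Fin J → ℝ) : ℝ := ∑ j, p j * q j

/-- `γ_i = e_i − e_{i+1}` for `i < J`, and `γ_J = e_J` (0-indexed). -/
def gam (J : ℕ) (i : Fin J) : Fin J → ℝ :=
  fun j => (if j = i then (1 : ℝ) else 0) - (if (j : ℕ) = (i : ℕ) + 1 then (1 : ℝ) else 0)

/-- `b_i = β_i (e_1 + ⋯ + e_i)` (0-indexed: coordinates `j ≤ i`). -/
def bvec {J : ℕ} (β : Fin J → ℝ) (i : Fin J) : Fin J → ℝ :=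
  fun j => if (j : ℕ) ≤ (i : ℕ) then β i else 0

/-- The domain `G`. -/
def domG {J : ℕ} [NeZero J] (z : Fin J → ℝ) : Set (Fin J → ℝ) :=
  {x | (∀ i, 0 ≤ x i) ∧ x 0 < z 0 ∧ ∀ i : Fin J, i ≠ 0 → x i ≤ z i}

/-- The boundary portion `∂_o G`. -/
def bdO {J : ℕ} [NeZero J] (z : Fin J → ℝ) : Set (Fin J → ℝ) :=
  {x | x 0 = z 0 ∧ ∀ i : Fin J, i ≠ 0 → 0 ≤ x i ∧ x i ≤ z i}

/-- The boundary portion `∂_c G`. -/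
def bdC {J : ℕ} [NeZero J] (z : Fin J → ℝ) : Set (Fin J → ℝ) :=
  {x | x ∈ domG z ∧ ∃ i : Fin J, i ≠ 0 ∧ x i = z i}

/-- The Hamiltonian `H(p) = c + λ(1 − e^{−p_1}) + Σ_i max(0, μ_i(1 − e^{γ_i·p}))`. -/
def Ham {J : ℕ} [NeZero J] (lam c : ℝ) (μ : Fin J → ℝ) (p : Fin J → ℝ) : ℝ :=
  c + lam * (1 - Real.exp (-(p 0))) +
    ∑ i, max 0 (μ i * (1 - Real.exp (dotJ (gam J i) p)))

/-- Superdifferential of `V` at `x`, relative to the set `G`. -/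
def supDiff {J : ℕ} (G : Set (Fin J → ℝ)) (V : (Fin J → ℝ) → ℝ) (x : Fin J → ℝ) :
    Set (Fin J → ℝ) :=
  {p | ∀ ε > 0, ∃ r > 0, ∀ y ∈ G, ‖y - x‖ < r →
    V y - V x - dotJ p (y - x) ≤ ε * ‖y - x‖}

/-- Subdifferential of `V` at `x`, relative to the set `G`. -/
def subDiff {J : ℕ} (G : Set (Fin J → ℝ)) (V : (Fin J → ℝ) → ℝ) (x : Fin J → ℝ) :
    Set (Fin J → ℝ) :=
  {p | ∀ ε > 0, ∃ r > 0, ∀ y ∈ G, ‖y - x‖ < r →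
    -(ε * ‖y - x‖) ≤ V y - V x - dotJ p (y - x)}

/-- `A' = {i : μ_i ≤ μ_j for all j < i}`. -/
def Aprime {J : ℕ} (μ : Fin J → ℝ) : Set (Fin J) := {i | ∀ j, j < i → μ i ≤ μ j}

/-- `A(x) = {i ∈ A' : i+1 ∉ B(x), or every j > i with [i+1,j] ⊆ B(x) has μ_i < μ_j}`. -/
def Aset {J : ℕ} (μ z x : Fin J → ℝ) : Set (Fin J) :=
  {i | i ∈ Aprime μ ∧
    ((∀ h : (i : ℕ) + 1 < J, x ⟨(i : ℕ) + 1, h⟩ ≠ z ⟨(i : ℕ) + 1, h⟩) ∨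
      ∀ j : Fin J, i < j → (∀ k : Fin J, i < k → k ≤ j → x k = z k) → μ i < μ j)}

/-- `l(x) = x log x − x + 1` (finite branch; `Real.log 0 = 0` gives `0·log 0 = 0`). -/
def lfun (x : ℝ) : ℝ := x * Real.log x - x + 1

/-- The control set `U = [0,1]^J`. -/
def Uset (J : ℕ) : Set (Fin J → ℝ) := {u | ∀ i, 0 ≤ u i ∧ u i ≤ 1}

/-- The perturbation set `M = {(λ̄, μ̄) : λ̄ ≥ 0, μ̄_i ≥ 0}`. -/
def Mset (J : ℕ) : Set (ℝ × (Fin J → ℝ)) := {m | 0 ≤ m.1 ∧ ∀ i, 0 ≤ m.2 i}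

/-- `H(p,u,m) = c + p·(λ̄ e_1 − Σ_i u_i μ̄_i γ_i) + λ l(λ̄/λ) + Σ_i u_i μ_i l(μ̄_i/μ_i)`. -/
def Hpum {J : ℕ} [NeZero J] (lam c : ℝ) (μ : Fin J → ℝ) (p u : Fin J → ℝ)
    (m : ℝ × (Fin J → ℝ)) : ℝ :=
  c + dotJ p (fun j => m.1 * (if j = 0 then 1 else 0) - ∑ i, u i * m.2 i * gam J i j)
    + lam * lfun (m.1 / lam) + ∑ i, u i * (μ i * lfun (m.2 i / μ i))

/-- `h(ν,δ) = c + λ(1 − e^{Σ_i ν_i β_i − δ_1}) + Σ_i μ_i(1 − e^{−ν_i β_i + δ_i − δ_{i+1}})`,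
with `ν ∈ ℝ^J` and `δ ∈ ℝ^{J+1}`. -/
def hFun {J : ℕ} (lam c : ℝ) (μ β : Fin J → ℝ)
    (q : (Fin J → ℝ) × (Fin (J + 1) → ℝ)) : ℝ :=
  c + lam * (1 - Real.exp (∑ i, q.1 i * β i - q.2 0)) +
    ∑ i : Fin J, μ i * (1 - Real.exp (-(q.1 i * β i) + q.2 i.castSucc - q.2 i.succ))

/-- The constraint set `S` of pairs `(ν, δ)`. -/
def Sset {J : ℕ} (μ β z x : Fin J → ℝ) :
    Set ((Fin J → ℝ) × (Fin (J + 1) → ℝ)) :=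
  {q | q.2 (Fin.last J) = 0 ∧
    (∀ i : Fin J, x i = 0 → 0 ≤ q.2 i.castSucc) ∧
    (∀ i : Fin J, x i = z i → q.2 i.castSucc ≤ 0) ∧
    (∀ i : Fin J, x i ≠ 0 → x i ≠ z i → q.2 i.castSucc = 0) ∧
    (∀ i ∈ Aset μ z x, 0 ≤ q.1 i) ∧
    (∀ i ∉ Aset μ z x, q.1 i = 0) ∧
    (∑ i, q.1 i) = 1 ∧
    ∀ i : Fin J, -(q.1 i * β i) + q.2 i.castSucc - q.2 i.succ ≤ 0}

/-- `s` = largest (1-indexed) `j ≤ k` with `j ∉ I(x)`, and `s = 0` if none exists. -/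
def sIdx {J : ℕ} (x : Fin J → ℝ) (k : Fin J) : ℕ :=
  sSup (insert 0 ((fun j : Fin J => (j : ℕ) + 1) '' {j | j ≤ k ∧ x j ≠ 0}))

/-- `t` = least (1-indexed) `j ∈ [k+1, J]` with `j ∉ B(x)`, and `t = J+1` if none exists. -/
def tIdx {J : ℕ} (z x : Fin J → ℝ) (k : Fin J) : ℕ :=
  sInf (insert (J + 1) ((fun j : Fin J => (j : ℕ) + 1) '' {j | k < j ∧ x j ≠ z j}))

/-- `δ^{(r,k)}_i = β_k (1_{i ≥ r+1} − 1_{i ≥ k+1})` (1-indexed `i`, `r`; coordinates of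
`Fin (J+1)` are the 1-indexed positions shifted by one). -/
def delrk {J : ℕ} (β : Fin J → ℝ) (k : Fin J) (r : ℕ) : Fin (J + 1) → ℝ :=
  fun i => β k * ((if r ≤ (i : ℕ) then 1 else 0) - (if (k : ℕ) + 1 ≤ (i : ℕ) then 1 else 0))

/-! ### Helper lemmas -/

/-- Extension of a vector by zero. -/
def extz {J : ℕ} (p : Fin J → ℝ) (n : ℕ) : ℝ := if h : n < J then p ⟨n, h⟩ else 0

lemma extz_fin {J : ℕ} (p : Fin J → ℝ) (i : Fin J) : extz p (i : ℕ) = p i := by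
  simp [extz]

lemma dotJ_range {J : ℕ} (p q : Fin J → ℝ) :
    dotJ p q = ∑ j ∈ Finset.range J, extz p j * extz q j := by
  rw [Finset.sum_range]
  simp [dotJ, extz_fin]

lemma dotJ_gam {J : ℕ} (p : Fin J → ℝ) (i : Fin J) :
    dotJ p (gam J i) = extz p i - extz p (i + 1) := by
  unfold dotJ gam
  simp only [mul_sub, Finset.sum_sub_distrib, mul_ite, mul_one, mul_zero]
  congr 1
  · simp [extz_fin]
  · by_cases h : (i : ℕ) + 1 < J
    · have : ∀ j : Fin J, ((j : ℕ) = (i : ℕ) + 1) ↔ j = ⟨(i : ℕ) + 1, h⟩ := by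
        intro j; simp [Fin.ext_iff]
      simp [this, extz, h]
    · have : ∀ j : Fin J, ¬ ((j : ℕ) = (i : ℕ) + 1) := by
        intro j; have := j.2; omega
      simp [this, extz, h]

lemma dotJ_comm {J : ℕ} (p q : Fin J → ℝ) : dotJ p q = dotJ q p := by
  simp [dotJ, mul_comm]

lemma dotJ_smul {J : ℕ} (p v : Fin J → ℝ) (t : ℝ) : dotJ p (t • v) = t * dotJ p v := by
  simp only [dotJ, Finset.mul_sum, Pi.smul_apply, smul_eq_mul]
  refine Finset.sum_congr rfl fun j _ => by ring

lemma dotJ_line {J : ℕ} (b z x v : Fin J → ℝ) (t : ℝ) :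
    dotJ b (z - (x + t • v)) = dotJ b (z - x) - t * dotJ b v := by
  simp only [dotJ, Finset.mul_sum, ← Finset.sum_sub_distrib, Pi.smul_apply, smul_eq_mul,
    Pi.sub_apply, Pi.add_apply]
  refine Finset.sum_congr rfl fun j _ => by ring

/-- Abel summation. -/
lemma abel_sum (Q w : ℕ → ℝ) (hw : w 0 = 0) (n : ℕ) :
    ∑ j ∈ Finset.range n, Q j * (w (j + 1) - w j)
      = ∑ j ∈ Finset.range n, (Q j - Q (j + 1)) * w (j + 1) + Q n * w n := by
  induction n with
  | zero => simp [hw]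
  | succ n ih => rw [Finset.sum_range_succ, Finset.sum_range_succ, ih]; ring

lemma bvec_dot {J : ℕ} (β v : Fin J → ℝ) (i : Fin J) :
    dotJ (bvec β i) v = β i * ∑ j ∈ Finset.range ((i : ℕ) + 1), extz v j := by
  rw [dotJ_range, Finset.mul_sum]
  have hsub : Finset.range ((i : ℕ) + 1) ⊆ Finset.range J := by
    intro j; simp only [Finset.mem_range]; have := i.2; omega
  rw [← Finset.sum_subset hsub]
  · refine Finset.sum_congr rfl fun j hj => ?_
    have h1 := hsub hj
    simp only [Finset.mem_range] at hj h1
    have : j ≤ (i : ℕ) := by omega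
    simp [extz, h1, bvec, this]
  · intro j h1 h2
    simp only [Finset.mem_range] at h1 h2
    have : ¬ j ≤ (i : ℕ) := by omega
    simp [extz, h1, bvec, this]

/-- Feasible directions. -/
lemma feasible {J : ℕ} [NeZero J] {z x v : Fin J → ℝ} (hx : x ∈ domG z)
    (h0 : ∀ j, x j = 0 → 0 ≤ v j) (h1 : ∀ j, j ≠ 0 → x j = z j → v j ≤ 0) :
    ∀ᶠ t in nhdsWithin (0 : ℝ) (Set.Ioi 0), x + t • v ∈ domG z := by
  obtain ⟨hx0, hx1, hx2⟩ := hx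
  have hc : ∀ j, Filter.Tendsto (fun t : ℝ => x j + t * v j) (nhdsWithin (0 : ℝ) (Set.Ioi 0))
      (nhds (x j)) := by
    intro j
    have : Continuous (fun t : ℝ => x j + t * v j) := by fun_prop
    have h := (this.tendsto 0).mono_left (nhdsWithin_le_nhds (s := Set.Ioi (0 : ℝ)))
    simpa using h
  have e1 : ∀ᶠ t in nhdsWithin (0 : ℝ) (Set.Ioi 0), ∀ j, 0 ≤ x j + t * v j := by
    rw [Filter.eventually_all]
    intro j
    rcases (hx0 j).eq_or_lt with h | h
    · filter_upwards [self_mem_nhdsWithin] with t ht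
      rw [← h, zero_add]
      exact mul_nonneg (le_of_lt ht) (h0 j h.symm)
    · filter_upwards [(hc j).eventually (lt_mem_nhds h)] with t ht using ht.le
  have e2 : ∀ᶠ t in nhdsWithin (0 : ℝ) (Set.Ioi 0), ∀ j, j ≠ 0 → x j + t * v j ≤ z j := by
    rw [Filter.eventually_all]
    intro j
    by_cases hj : j = 0
    · simp [hj]
    rcases (hx2 j hj).eq_or_lt with h | h
    · filter_upwards [self_mem_nhdsWithin] with t ht _
      have := mul_nonneg (le_of_lt (show (0:ℝ) < t from ht)) (neg_nonneg.2 (h1 j hj h))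
      linarith
    · filter_upwards [(hc j).eventually (gt_mem_nhds h)] with t ht _ using le_of_lt ht
  filter_upwards [e1, e2, (hc 0).eventually (gt_mem_nhds hx1)] with t a b c
  exact ⟨a, c, b⟩

lemma small_step {J : ℕ} (x v : Fin J → ℝ) {r : ℝ} (hr : 0 < r) :
    ∀ᶠ t in nhdsWithin (0 : ℝ) (Set.Ioi 0), ‖(x + t • v) - x‖ < r := by
  have : Continuous (fun t : ℝ => ‖(x + t • v) - x‖) := by fun_prop
  have h := (this.tendsto 0).mono_left (nhdsWithin_le_nhds (s := Set.Ioi (0 : ℝ)))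
  simp only [zero_smul, add_zero, sub_self, norm_zero] at h
  exact h.eventually (gt_mem_nhds hr)

lemma sup_dir {J : ℕ} {G : Set (Fin J → ℝ)} {V : (Fin J → ℝ) → ℝ} {x p v : Fin J → ℝ} {d : ℝ}
    (hp : p ∈ supDiff G V x)
    (hf : ∀ᶠ t in nhdsWithin (0 : ℝ) (Set.Ioi 0), x + t • v ∈ G)
    (hd : ∀ᶠ t in nhdsWithin (0 : ℝ) (Set.Ioi 0), V x + t * d ≤ V (x + t • v)) :
    d ≤ dotJ p v := by
  refine le_of_forall_pos_le_add fun ε hε => ?_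
  have hn : 0 < ‖v‖ + 1 := by positivity
  obtain ⟨r, hr, h⟩ := hp (ε / (‖v‖ + 1)) (by positivity)
  have hpos : ∀ᶠ t in nhdsWithin (0 : ℝ) (Set.Ioi 0), (0 : ℝ) < t := self_mem_nhdsWithin
  obtain ⟨t, ht, hG, hV, hs⟩ :=
    (hpos.and (hf.and (hd.and (small_step x v hr)))).exists
  have ht : (0 : ℝ) < t := ht
  have h1 := h _ hG hs
  rw [add_sub_cancel_left, dotJ_smul, norm_smul, Real.norm_of_nonneg ht.le] at h1
  have h2 : ε / (‖v‖ + 1) * (t * ‖v‖) ≤ t * ε := by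
    rw [div_mul_eq_mul_div, div_le_iff₀ hn]
    nlinarith [mul_pos hε ht]
  have h3 : t * d ≤ t * (dotJ p v + ε) := by linarith
  exact le_of_mul_le_mul_left h3 ht

lemma sub_dir {J : ℕ} {G : Set (Fin J → ℝ)} {V : (Fin J → ℝ) → ℝ} {x p v : Fin J → ℝ} {d : ℝ}
    (hp : p ∈ subDiff G V x)
    (hf : ∀ᶠ t in nhdsWithin (0 : ℝ) (Set.Ioi 0), x + t • v ∈ G)
    (hd : ∀ t : ℝ, 0 < t → V (x + t • v) ≤ V x + t * d) :
    dotJ p v ≤ d := by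
  refine le_of_forall_pos_le_add fun ε hε => ?_
  have hn : 0 < ‖v‖ + 1 := by positivity
  obtain ⟨r, hr, h⟩ := hp (ε / (‖v‖ + 1)) (by positivity)
  have hpos : ∀ᶠ t in nhdsWithin (0 : ℝ) (Set.Ioi 0), (0 : ℝ) < t := self_mem_nhdsWithin
  obtain ⟨t, ht, hG, hs⟩ :=
    (hpos.and (hf.and (small_step x v hr))).exists
  have ht : (0 : ℝ) < t := ht
  have hV := hd t ht
  have h1 := h _ hG hs
  rw [add_sub_cancel_left, dotJ_smul, norm_smul, Real.norm_of_nonneg ht.le] at h1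
  have h2 : ε / (‖v‖ + 1) * (t * ‖v‖) ≤ t * ε := by
    rw [div_mul_eq_mul_div, div_le_iff₀ hn]
    nlinarith [mul_pos hε ht]
  have h3 : t * dotJ p v ≤ t * (d + ε) := by linarith
  exact le_of_mul_le_mul_left h3 ht

lemma V_le {J : ℕ} (β z x : Fin J → ℝ) (i : Fin J) :
    (⨅ i, dotJ (bvec β i) (z - x)) ≤ dotJ (bvec β i) (z - x) :=
  ciInf_le (Set.finite_range _).bddBelow i

lemma V_att {J : ℕ} [NeZero J] (β z x : Fin J → ℝ) :
    ∃ i, dotJ (bvec β i) (z - x) = ⨅ i, dotJ (bvec β i) (z - x) :=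
  exists_eq_ciInf_of_finite

lemma V_lip {J : ℕ} [NeZero J] (β z : Fin J → ℝ) : ∃ K : NNReal, LipschitzWith K
    (fun x => ⨅ i, dotJ (bvec β i) (z - x)) := by
  refine ⟨Real.toNNReal (∑ i, ∑ j, |bvec β i j|), LipschitzWith.of_le_add_mul _ fun x y => ?_⟩
  have hK : 0 ≤ ∑ i, ∑ j, |bvec β i j| := by positivity
  rw [Real.coe_toNNReal _ hK]
  obtain ⟨i, hi⟩ := V_att β z y
  have h1 := V_le β z x i
  have h2 : dotJ (bvec β i) (z - x) - dotJ (bvec β i) (z - y) ≤ (∑ j, |bvec β i j|) * dist x y := by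
    simp only [dotJ, Finset.sum_mul, ← Finset.sum_sub_distrib]
    refine Finset.sum_le_sum fun j _ => ?_
    have : bvec β i j * (z - x) j - bvec β i j * (z - y) j = bvec β i j * (y j - x j) := by
      simp; ring
    rw [this]
    refine (le_abs_self _).trans ?_
    rw [abs_mul]
    refine mul_le_mul_of_nonneg_left ?_ (abs_nonneg _)
    rw [dist_comm, ← Real.dist_eq]
    exact dist_le_pi_dist y x j
  have h3 : (∑ j, |bvec β i j|) ≤ ∑ i, ∑ j, |bvec β i j| :=
    Finset.single_le_sum (f := fun i => ∑ j, |bvec β i j|)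
      (fun i _ => by positivity) (Finset.mem_univ i)
  have h4 := mul_le_mul_of_nonneg_right h3 (dist_nonneg (x := x) (y := y))
  linarith

lemma V_bd {J : ℕ} [NeZero J] (β z : Fin J → ℝ) (hβ : ∀ i, 0 < β i) (x) (hx : x ∈ bdO z) :
    (⨅ i, dotJ (bvec β i) (z - x)) = 0 := by
  obtain ⟨h0, h1⟩ := hx
  apply le_antisymm
  · refine (V_le β z x 0).trans ?_
    rw [bvec_dot]
    have : extz (z - x) 0 = 0 := by
      simp [extz, h0, NeZero.pos J]
    simp [this]
  · refine le_ciInf fun i => ?_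
    refine Finset.sum_nonneg fun j _ => mul_nonneg ?_ ?_
    · unfold bvec; split_ifs
      · exact (hβ i).le
      · exact le_rfl
    · by_cases hj : j = 0
      · subst hj; simp [h0]
      · simp [(h1 j hj).2]

lemma Ham_neg_bvec {J : ℕ} [NeZero J] (lam c : ℝ) (μ β : Fin J → ℝ) (hμ : ∀ i, 0 < μ i)
    (hβ : ∀ i, 0 < β i ∧
      c + lam * (1 - Real.exp (β i)) + μ i * (1 - Real.exp (-(β i))) = 0) (i : Fin J) :
    Ham lam c μ (fun j => - bvec β i j) = 0 := by
  unfold Ham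
  have h0 : bvec β i 0 = β i := by simp [bvec]
  rw [Finset.sum_eq_single i]
  · have : dotJ (gam J i) (fun j => - bvec β i j) = - β i := by
      rw [dotJ_comm, dotJ_gam, extz_fin]
      simp [bvec, extz]
    rw [this]
    simp only [h0, neg_neg]
    rw [max_eq_right]
    · exact (hβ i).2
    · refine mul_nonneg (hμ i).le ?_
      have : Real.exp (-β i) < 1 := by simpa using (hβ i).1
      linarith
  · intro k _ hk
    have : dotJ (gam J k) (fun j => - bvec β i j) = 0 := by
      rw [dotJ_comm, dotJ_gam, extz_fin]
      have hk' : (k : ℕ) ≠ i := fun h => hk (Fin.ext h)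
      have := i.2
      simp only [bvec, extz]
      split_ifs <;> first | omega | simp
    simp [this]
  · simp

lemma sub_part {J : ℕ} [NeZero J] (lam c : ℝ) (μ z β : Fin J → ℝ)
    (hμ : ∀ i, 0 < μ i) (hz : ∀ i, 0 < z i)
    (hβ : ∀ i, 0 < β i ∧
      c + lam * (1 - Real.exp (β i)) + μ i * (1 - Real.exp (-(β i))) = 0)
    (x) (hx : x ∈ domG z \ bdC z) (p)
    (hp : p ∈ subDiff (domG z) (fun y => ⨅ i, dotJ (bvec β i) (z - y)) x) :
    Ham lam c μ p ≤ 0 ∨ ∃ i : Fin J, x i = 0 ∧ dotJ p (gam J i) ≤ 0 := by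
  obtain ⟨hxG, hxB⟩ := hx
  have hB : ∀ j, j ≠ 0 → x j ≠ z j := fun j hj h => hxB ⟨hxG, j, hj, h⟩
  obtain ⟨i, hi⟩ := V_att β z x
  have key : ∀ v : Fin J → ℝ, (∀ j, x j = 0 → 0 ≤ v j) → dotJ p v ≤ - dotJ (bvec β i) v := by
    intro v hv
    refine sub_dir hp (feasible hxG hv fun j hj h => absurd h (hB j hj)) fun t ht => ?_
    have := V_le β z (x + t • v) i
    rw [dotJ_line] at this
    linarith
  by_cases hI : ∃ j, x j = 0
  · right
    classical
    have hne : (Finset.univ.filter fun j => x j = 0).Nonempty := by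
      obtain ⟨j, hj⟩ := hI; exact ⟨j, by simpa using hj⟩
    obtain ⟨j, hj, hmax⟩ := Finset.exists_max_image _ id hne
    simp only [Finset.mem_filter, Finset.mem_univ, true_and, id] at hj hmax
    refine ⟨j, hj, (key _ ?_).trans ?_⟩
    · intro k hk
      have h1 : k ≤ j := hmax k hk
      have h2 : ¬ ((k : ℕ) = (j : ℕ) + 1) := by
        have : (k : ℕ) ≤ j := h1
        omega
      simp only [gam, h2, if_false, sub_zero]
      split_ifs <;> norm_num
    · rw [dotJ_gam, extz_fin]
      have := (hβ i).1
      simp only [bvec, extz]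
      split_ifs <;> first | omega | linarith
  · left
    push Not at hI
    have : p = fun j => - bvec β i j := by
      funext j
      have a := key (Pi.single j 1) fun k hk => absurd hk (hI k)
      have b := key (Pi.single j (-1)) fun k hk => absurd hk (hI k)
      simp only [dotJ, Pi.single_apply, mul_ite, mul_one, mul_zero, Finset.sum_ite_eq',
        Finset.mem_univ, if_true, mul_neg] at a b
      linarith
    rw [this, Ham_neg_bvec lam c μ β hμ hβ i]

lemma exp_tangent (s y : ℝ) : Real.exp s * (1 + y - s) ≤ Real.exp y := by
  have h1 := Real.add_one_le_exp (y - s)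
  have h2 : Real.exp y = Real.exp s * Real.exp (y - s) := by
    rw [← Real.exp_add]; congr 1; ring
  rw [h2]
  exact mul_le_mul_of_nonneg_left (by linarith) (Real.exp_pos s).le

lemma main_ineq {J : ℕ} (lam c : ℝ) (μ β h : Fin J → ℝ)
    (hlam : 0 < lam) (hc : 0 < c) (hμ : ∀ i, 0 < μ i)
    (hβ : ∀ i, 0 < β i ∧
      c + lam * (1 - Real.exp (β i)) + μ i * (1 - Real.exp (-(β i))) = 0)
    (hh : ∀ i, 0 ≤ h i) (hs : ∑ i, h i * (1 / β i) ≤ 1) :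
    0 ≤ c + lam * (1 - Real.exp (∑ i, h i)) + ∑ i, μ i * (1 - Real.exp (-(h i))) := by
  obtain ⟨a, ha⟩ : ∃ a : Fin J → ℝ, ∀ i, a i = h i * (1 / β i) := ⟨_, fun _ => rfl⟩
  have hb : ∀ i, h i = a i * β i := by
    intro i
    have := (hβ i).1.ne'
    rw [ha]; field_simp
  have ha0 : ∀ i, 0 ≤ a i := fun i => by
    rw [ha]; exact mul_nonneg (hh i) (one_div_nonneg.2 (hβ i).1.le)
  have hA : ∑ i, a i ≤ 1 := by simpa only [ha] using hs
  have ha1 : ∀ i, a i ≤ 1 := fun i =>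
    (Finset.single_le_sum (fun i _ => ha0 i) (Finset.mem_univ i)).trans hA
  have e1 : ∀ i, a i * (lam * (Real.exp (β i) - 1) - c) ≤ μ i * (1 - Real.exp (-(h i))) := by
    intro i
    have h1 := exp_tangent (-(h i)) (-(β i))
    have h2 := exp_tangent (-(h i)) 0
    rw [Real.exp_zero] at h2
    have h3 := mul_le_mul_of_nonneg_left h1 (ha0 i)
    have h4 := mul_le_mul_of_nonneg_left h2 (sub_nonneg.2 (ha1 i))
    have h5 : a i * (1 - Real.exp (-(β i))) ≤ 1 - Real.exp (-(h i)) := by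
      have : a i * (Real.exp (-h i) * (1 + -β i - -h i)) +
        (1 - a i) * (Real.exp (-h i) * (1 + 0 - -h i)) = Real.exp (-h i) := by
        have := hb i
        linear_combination (Real.exp (-h i)) * this
      linarith
    have h6 : lam * (Real.exp (β i) - 1) - c = μ i * (1 - Real.exp (-(β i))) := by
      linarith [(hβ i).2]
    rw [h6]
    calc _ = μ i * (a i * (1 - Real.exp (-(β i)))) := by ring
      _ ≤ _ := mul_le_mul_of_nonneg_left h5 (hμ i).le
  have e2 := Finset.sum_le_sum (s := Finset.univ) fun i _ => e1 i
  obtain ⟨S, hS⟩ : ∃ S, S = ∑ i, h i := ⟨_, rfl⟩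
  obtain ⟨A, hAA⟩ : ∃ A, A = ∑ i, a i := ⟨_, rfl⟩
  have e3 : Real.exp S ≤ ∑ i, a i * Real.exp (β i) + (1 - A) := by
    have h2 := exp_tangent S 0
    rw [Real.exp_zero] at h2
    have h4 := mul_le_mul_of_nonneg_left h2 (sub_nonneg.2 (hAA ▸ hA))
    have h5 : ∑ i, a i * (Real.exp S * (1 + β i - S)) ≤ ∑ i, a i * Real.exp (β i) :=
      Finset.sum_le_sum fun i _ => mul_le_mul_of_nonneg_left (exp_tangent S (β i)) (ha0 i)
    have h6 : ∑ i, a i * (Real.exp S * (1 + β i - S)) = Real.exp S * (A + S - A * S) := by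
      have : ∀ i, a i * (Real.exp S * (1 + β i - S))
          = Real.exp S * a i + Real.exp S * h i - Real.exp S * S * a i := by
        intro i; rw [hb i]; ring
      simp only [this, Finset.sum_sub_distrib, Finset.sum_add_distrib, ← Finset.mul_sum]
      rw [← hS, ← hAA]; ring
    nlinarith
  have e4 : ∑ i, a i * (lam * (Real.exp (β i) - 1) - c)
      = lam * (∑ i, a i * Real.exp (β i)) - (lam + c) * A := by
    have : ∀ i, a i * (lam * (Real.exp (β i) - 1) - c)
      = lam * (a i * Real.exp (β i)) - (lam + c) * a i := by intro i; ring
    simp only [this, Finset.sum_sub_distrib, ← Finset.mul_sum]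
    rw [← hAA]
  rw [← hS]
  have e5 := mul_le_mul_of_nonneg_left e3 hlam.le
  have e6 : c * A ≤ c * 1 := mul_le_mul_of_nonneg_left (hAA ▸ hA) hc.le
  rw [e4] at e2
  linarith

/-- Backward recursion for the modified potential. -/
lemma back_rec (J : ℕ) (st : ℕ → Prop) (base : ℕ → ℝ) :
    ∃ f : ℕ → ℝ, ∀ r, (r < J → st r → f r = f (r + 1)) ∧ (r < J → ¬ st r → f r = base r) ∧
      (J ≤ r → f r = 0) := by
  classical
  let F : ℕ → ℝ := fun n => Nat.rec (motive := fun _ => ℝ) 0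
    (fun n y => if st (J - (n + 1)) then y else base (J - (n + 1))) n
  have hF : ∀ n, F (n + 1) = if st (J - (n + 1)) then F n else base (J - (n + 1)) := fun n => rfl
  refine ⟨fun r => F (J - r), fun r => ⟨fun hr hs => ?_, fun hr hs => ?_, fun hr => ?_⟩⟩
  · have h1 : J - r = (J - (r + 1)) + 1 := by omega
    have h2 : J - ((J - (r + 1)) + 1) = r := by omega
    simp only
    rw [h1, hF, h2, if_pos hs]
  · have h1 : J - r = (J - (r + 1)) + 1 := by omega
    have h2 : J - ((J - (r + 1)) + 1) = r := by omega
    simp only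
    rw [h1, hF, h2, if_neg hs]
  · have h1 : J - r = 0 := by omega
    simp only
    rw [h1]
    rfl

lemma combi (J : ℕ) (P φ : ℕ → ℝ) (I B : ℕ → Prop) (hPJ : P J = 0) (hφ : ∀ r, 0 ≤ φ r)
    (hIJ : ∀ j, I j → j < J) (hBJ : ∀ j, B j → j < J) (hIB : ∀ j, I j → ¬ B j)
    (hI : ∀ j, I j → P j < P (j + 1))
    (hφI : ∀ r, I (r + 1) → φ r ≤ φ (r + 1)) (hφB : ∀ r, B (r + 1) → φ (r + 1) ≤ φ r) :
    ∃ f Q : ℕ → ℝ, (∀ r, 0 ≤ f r) ∧ (∀ r, f r ≤ φ r) ∧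
      (∀ r, I (r + 1) → f r ≤ f (r + 1)) ∧ (∀ r, B (r + 1) → f (r + 1) ≤ f r) ∧
      Q 0 = P 0 ∧ Q J = 0 ∧ (∀ r, Q (r + 1) - Q r ≤ max (P (r + 1) - P r) 0) ∧
      (∀ r, r + 1 < J → Q (r + 1) ≠ P (r + 1) → f (r + 1) = f r) ∧
      (∀ r, r < J → f r * (Q (r + 1) - Q r) = φ r * max (Q (r + 1) - Q r) 0) := by
  classical
  obtain ⟨Q, hQ0, hQ⟩ : ∃ Q : ℕ → ℝ, Q 0 = P 0 ∧
      ∀ n, Q (n + 1) = if B (n + 1) then max (P (n + 1)) (Q n) else P (n + 1) :=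
    ⟨fun n => Nat.rec (motive := fun _ => ℝ) (P 0)
      (fun n y => if B (n + 1) then max (P (n + 1)) y else P (n + 1)) n, rfl, fun n => rfl⟩
  have hQP : ∀ n, P n ≤ Q n := by
    intro n
    cases n with
    | zero => exact hQ0.ge
    | succ n => rw [hQ]; split_ifs <;> simp
  have hQnB : ∀ n, ¬ B n → Q n = P n := by
    intro n hn
    cases n with
    | zero => exact hQ0
    | succ n => rw [hQ, if_neg hn]
  obtain ⟨f, hf⟩ := back_rec J (fun r => B (r + 1) ∧ P (r + 1) < Q r)
    (fun r => if Q (r + 1) < Q r then 0 else φ r)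
  have hst : ∀ r, B (r + 1) → P (r + 1) < Q r → Q (r + 1) = Q r := by
    intro r hb h
    rw [hQ, if_pos hb, max_eq_right h.le]
  have hBQ : ∀ r, B (r + 1) → Q r ≤ Q (r + 1) := by
    intro r hb
    rw [hQ, if_pos hb]; exact le_max_right _ _
  have hfb : ∀ n r, J - r = n → 0 ≤ f r ∧ f r ≤ φ r := by
    intro n
    induction n with
    | zero =>
      intro r hr
      rw [(hf r).2.2 (by omega)]
      exact ⟨le_rfl, hφ r⟩
    | succ n ih =>
      intro r hr
      have hrJ : r < J := by omega
      by_cases h : B (r + 1) ∧ P (r + 1) < Q r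
      · rw [(hf r).1 hrJ h]
        have := ih (r + 1) (by omega)
        exact ⟨this.1, this.2.trans (hφB r h.1)⟩
      · rw [(hf r).2.1 hrJ h]
        split_ifs
        · exact ⟨le_rfl, hφ r⟩
        · exact ⟨hφ r, le_rfl⟩
  have hf0 : ∀ r, 0 ≤ f r := fun r => (hfb _ r rfl).1
  have hf1 : ∀ r, f r ≤ φ r := fun r => (hfb _ r rfl).2
  refine ⟨f, Q, hf0, hf1, ?_, ?_, hQ0, ?_, ?_, ?_, ?_⟩
  · intro r hi
    have h1 := hQnB _ (hIB _ hi)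
    have h2 := hI _ hi
    have h3 := hQP (r + 1 + 1)
    have : f (r + 1) = φ (r + 1) := by
      rw [(hf (r + 1)).2.1 (hIJ _ hi), if_neg]
      · linarith
      · rintro ⟨_, h⟩; linarith
    rw [this]
    exact (hf1 r).trans (hφI r hi)
  · intro r hb
    have hrJ : r < J := by have := hBJ _ hb; omega
    by_cases h : P (r + 1) < Q r
    · rw [(hf r).1 hrJ ⟨hb, h⟩]
    · rw [(hf r).2.1 hrJ (fun h' => h h'.2), if_neg (not_lt.2 (hBQ r hb))]
      exact (hf1 _).trans (hφB r hb)
  · rw [hQnB J (fun h => lt_irrefl _ (hBJ _ h)), hPJ]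
  · intro r
    have := hQP r
    rw [hQ]
    split_ifs
    · rcases max_cases (P (r + 1)) (Q r) with h | h <;>
      rcases max_cases (P (r + 1) - P r) 0 with h' | h' <;> linarith
    · exact le_max_of_le_left (by linarith)
  · intro r hr hne
    have hb : B (r + 1) := by
      by_contra hb; exact hne (hQnB _ hb)
    have h : P (r + 1) < Q r := by
      by_contra h
      apply hne
      rw [hQ, if_pos hb, max_eq_left (not_lt.1 h)]
    exact ((hf r).1 (by omega) ⟨hb, h⟩).symm
  · intro r hr
    by_cases h : B (r + 1) ∧ P (r + 1) < Q r
    · rw [hst r h.1 h.2]; simp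
    · rw [(hf r).2.1 hr h]
      split_ifs with h'
      · rw [max_eq_right (by linarith)]; simp
      · rw [max_eq_left (by linarith)]

/-- The potential. -/
lemma exists_phi {J : ℕ} [NeZero J] (z x β : Fin J → ℝ) (hz : ∀ i, 0 < z i)
    (hβ : ∀ i, 0 < β i) (hx : x ∈ domG z) :
    ∃ φ : ℕ → ℝ, (∀ r, 0 ≤ φ r) ∧ (∀ r : Fin J, 1 / β r ≤ φ r) ∧
      (∀ k : Fin J, dotJ (bvec β k) (z - x) = (⨅ i, dotJ (bvec β i) (z - x)) → φ k ≤ 1 / β k) ∧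
      (∀ (r : ℕ) (h : r + 1 < J), x ⟨r + 1, h⟩ = 0 → φ r ≤ φ (r + 1)) ∧
      (∀ (r : ℕ) (h : r + 1 < J), x ⟨r + 1, h⟩ = z ⟨r + 1, h⟩ → φ (r + 1) ≤ φ r) := by
  classical
  obtain ⟨hx0, hx1, hx2⟩ := hx
  set act : Fin J → Prop := fun k =>
    dotJ (bvec β k) (z - x) = (⨅ i, dotJ (bvec β i) (z - x)) with hact
  let reach : Fin J → ℕ → Prop := fun k r =>
    (r ≤ k ∧ ∀ j : Fin J, r < j → j ≤ k → x j = 0) ∨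
    ((k : ℕ) ≤ r ∧ ∀ j : Fin J, k < j → (j : ℕ) ≤ r → x j = z j)
  set M : ℝ := ∑ k, 1 / β k with hM
  have hb0 : ∀ k, 0 ≤ 1 / β k := fun k => one_div_nonneg.2 (hβ k).le
  have hbM : ∀ k, 1 / β k ≤ M := fun k =>
    Finset.single_le_sum (fun i _ => hb0 i) (Finset.mem_univ k)
  let W : ℕ → Fin J → ℝ := fun r k => if act k ∧ reach k r then 1 / β k else M
  have mono : ∀ r r', (∀ k, reach k r → reach k r') → (⨅ k, W r' k) ≤ ⨅ k, W r k := by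
    intro r r' h
    refine ciInf_mono (Set.finite_range _).bddBelow fun k => ?_
    simp only [W]
    by_cases h1 : act k ∧ reach k r
    · rw [if_pos h1, if_pos ⟨h1.1, h k h1.2⟩]
    · rw [if_neg h1]
      split_ifs
      · exact hbM k
      · exact le_rfl
  have hpos : ∀ j : Fin J, 0 ≤ z j - x j := by
    intro j
    by_cases hj : j = 0
    · subst hj; linarith
    · linarith [hx2 j hj]
  have hpe : ∀ n, 0 ≤ extz (z - x) n := by
    intro n; unfold extz; split_ifs
    · exact hpos _
    · exact le_rfl
  have hS : ∀ n, 0 < ∑ j ∈ Finset.range (n + 1), extz (z - x) j := by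
    intro n
    have h1 : extz (z - x) 0 ≤ ∑ j ∈ Finset.range (n + 1), extz (z - x) j :=
      Finset.single_le_sum (fun i _ => hpe i) (by simp)
    have h2 : extz (z - x) 0 = z 0 - x 0 := by simp [extz, NeZero.pos J]
    linarith
  have hreach : ∀ k r : Fin J, act k → reach k r → β k ≤ β r := by
    intro k r hk hr
    have h1 : dotJ (bvec β k) (z - x) ≤ dotJ (bvec β r) (z - x) := by
      rw [show dotJ (bvec β k) (z - x) = _ from hk]; exact V_le β z x r
    rw [bvec_dot, bvec_dot] at h1
    have h2 : ∑ j ∈ Finset.range ((r : ℕ) + 1), extz (z - x) j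
        ≤ ∑ j ∈ Finset.range ((k : ℕ) + 1), extz (z - x) j := by
      rcases hr with ⟨hr, -⟩ | ⟨hr, hB⟩
      · refine Finset.sum_le_sum_of_subset_of_nonneg ?_ fun i _ _ => hpe i
        intro j; simp only [Finset.mem_range]; omega
      · refine le_of_eq (Finset.sum_subset ?_ ?_).symm
        · intro j; simp only [Finset.mem_range]; omega
        · intro j h1 h2
          simp only [Finset.mem_range] at h1 h2
          have hj : j < J := by have := r.2; omega
          have := hB ⟨j, hj⟩ (by rw [Fin.lt_def]; simp only; omega) (by simp only; omega)
          simp [extz, hj, this]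
    have h3 := mul_le_mul_of_nonneg_left h2 (hβ r).le
    exact le_of_mul_le_mul_right (h1.trans h3) (hS k)
  refine ⟨fun r => ⨅ k, W r k, ?_, ?_, ?_, ?_, ?_⟩
  · intro r
    refine le_ciInf fun k => ?_
    simp only [W]
    split_ifs
    · exact hb0 k
    · exact (hb0 k).trans (hbM k)
  · intro r
    refine le_ciInf fun k => ?_
    simp only [W]
    split_ifs with h
    · exact one_div_le_one_div_of_le (hβ k) (hreach k r h.1 h.2)
    · exact hbM r
  · intro k hk
    refine (ciInf_le (Set.finite_range _).bddBelow k).trans (le_of_eq ?_)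
    simp only [W]
    rw [if_pos]
    refine ⟨hk, Or.inl ⟨le_rfl, fun j h1 h2 => ?_⟩⟩
    exact absurd h1 (not_lt.2 h2)
  · intro r h hI
    refine mono _ _ fun k hk => ?_
    rcases hk with ⟨h1, h2⟩ | ⟨h1, h2⟩
    · refine Or.inl ⟨by omega, fun j a b => ?_⟩
      by_cases hj : (j : ℕ) = r + 1
      · rw [← hI]; congr 1; exact Fin.ext hj
      · exact h2 j (by omega) b
    · by_cases hk : (k : ℕ) = r + 1
      · refine Or.inl ⟨by omega, fun j a b => ?_⟩
        rw [← hI]; congr 1; apply Fin.ext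
        have : (j : ℕ) ≤ k := b
        simp only; omega
      · have := h2 ⟨r + 1, h⟩ (by rw [Fin.lt_def]; simp only; omega) (by simp)
        have := hz ⟨r + 1, h⟩
        linarith
  · intro r h hB
    refine mono _ _ fun k hk => ?_
    rcases hk with ⟨h1, h2⟩ | ⟨h1, h2⟩
    · by_cases hk : (k : ℕ) = r
      · refine Or.inr ⟨by omega, fun j a b => ?_⟩
        have a' : (k : ℕ) < j := a
        have : j = ⟨r + 1, h⟩ := by apply Fin.ext; simp only; omega
        rw [this, hB]
      · have := h2 ⟨r + 1, h⟩ (by simp) (by rw [Fin.le_def]; simp only; omega)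
        have := hz ⟨r + 1, h⟩
        linarith
    · refine Or.inr ⟨by omega, fun j a b => ?_⟩
      by_cases hj : (j : ℕ) = r + 1
      · have : j = ⟨r + 1, h⟩ := Fin.ext hj
        rw [this, hB]
      · exact h2 j a (by omega)

lemma sup_part {J : ℕ} [NeZero J] (lam c : ℝ) (μ z β : Fin J → ℝ)
    (hlam : 0 < lam) (hc : 0 < c) (hμ : ∀ i, 0 < μ i) (hz : ∀ i, 0 < z i)
    (hβ : ∀ i, 0 < β i ∧
      c + lam * (1 - Real.exp (β i)) + μ i * (1 - Real.exp (-(β i))) = 0)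
    (x) (hx : x ∈ domG z) (p)
    (hp : p ∈ supDiff (domG z) (fun y => ⨅ i, dotJ (bvec β i) (z - y)) x) :
    0 ≤ Ham lam c μ p ∨ ∃ i : Fin J, x i = 0 ∧ 0 ≤ dotJ p (gam J i) := by
  by_contra hcon
  push Not at hcon
  obtain ⟨hH, hI⟩ := hcon
  apply absurd hH
  rw [not_lt]
  obtain ⟨φ, hφ0, hφβ, hφact, hφI, hφB⟩ := exists_phi z x β hz (fun i => (hβ i).1) hx
  obtain ⟨f, Q, hf0, hfφ, hfI, hfB, hQ0, hQJ, hQP, hfQ, hfQφ⟩ :=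
    combi J (extz p) φ (fun j => ∃ h : j < J, x ⟨j, h⟩ = 0)
      (fun j => ∃ h : j < J, x ⟨j, h⟩ = z ⟨j, h⟩) (by simp [extz]) hφ0
      (fun j h => h.1) (fun j h => h.1)
      (fun j ⟨h, h1⟩ ⟨_, h2⟩ => by have := hz ⟨j, h⟩; linarith)
      (fun j ⟨h, h1⟩ => by
        have := hI ⟨j, h⟩ h1
        rw [dotJ_gam] at this
        simp only at this
        linarith)
      (fun r ⟨h, h1⟩ => hφI r h h1) (fun r ⟨h, h1⟩ => hφB r h h1)
  -- the test direction
  obtain ⟨w, hw0, hw⟩ : ∃ w : ℕ → ℝ, w 0 = 0 ∧ ∀ n, w (n + 1) = f n :=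
    ⟨fun n => Nat.rec (motive := fun _ => ℝ) 0 (fun n _ => f n) n, rfl, fun n => rfl⟩
  obtain ⟨v, hv⟩ : ∃ v : Fin J → ℝ, ∀ j : Fin J, v j = w ((j : ℕ) + 1) - w j :=
    ⟨_, fun _ => rfl⟩
  have hve : ∀ j, j < J → extz v j = w (j + 1) - w j := by
    intro j hj; simp [extz, hj, hv]
  have hbv : ∀ i, dotJ (bvec β i) v = β i * f i := by
    intro i
    rw [bvec_dot]
    congr 1
    rw [Finset.sum_congr rfl (g := fun j => w (j + 1) - w j), Finset.sum_range_sub, hw, hw0,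
      sub_zero]
    intro j hj
    simp only [Finset.mem_range] at hj
    exact hve j (by have := i.2; omega)
  have hpv : -1 ≤ dotJ p v := by
    refine sup_dir hp (feasible hx ?_ ?_) ?_
    · rintro ⟨j, hj⟩ h0
      rw [hv]
      cases j with
      | zero => simp only [hw, hw0]; linarith [hf0 0]
      | succ j => simp only [hw]; linarith [hfI j ⟨hj, h0⟩]
    · rintro ⟨j, hj⟩ hne h0
      rw [hv]
      cases j with
      | zero => exact absurd rfl hne
      | succ j => simp only [hw]; linarith [hfB j ⟨hj, h0⟩]
    · have hev : ∀ᶠ t in nhdsWithin (0 : ℝ) (Set.Ioi 0), ∀ i : Fin J,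
          (⨅ i, dotJ (bvec β i) (z - x)) + t * (-1) ≤ dotJ (bvec β i) (z - (x + t • v)) := by
        rw [Filter.eventually_all]
        intro i
        simp only [dotJ_line, hbv]
        rcases (V_le β z x i).eq_or_lt with h | h
        · filter_upwards [self_mem_nhdsWithin] with t ht
          have ht : (0 : ℝ) < t := ht
          have h1 : β i * f i ≤ 1 := by
            have h2 := (hfφ i).trans (hφact i h.symm)
            rw [le_div_iff₀ (hβ i).1] at h2
            linarith
          have := mul_le_mul_of_nonneg_left h1 ht.le
          linarith
        · have hcont : Continuous (fun t : ℝ => dotJ (bvec β i) (z - x) - t * (β i * f i)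
              - t * (-1)) := by fun_prop
          have h' := (hcont.tendsto 0).mono_left (nhdsWithin_le_nhds (s := Set.Ioi (0 : ℝ)))
          simp only [zero_mul, sub_zero] at h'
          filter_upwards [h'.eventually (lt_mem_nhds h)] with t ht
          linarith
      filter_upwards [hev] with t ht
      exact le_ciInf ht
  -- rewrite the pairing
  have hsum : dotJ p v = - ∑ j ∈ Finset.range J, φ j * max (Q (j + 1) - Q j) 0 := by
    rw [dotJ_range]
    have h1 : ∑ j ∈ Finset.range J, extz p j * extz v j
        = ∑ j ∈ Finset.range J, Q j * (w (j + 1) - w j) := by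
      refine Finset.sum_congr rfl fun j hj => ?_
      rw [Finset.mem_range] at hj
      rw [hve j hj]
      cases j with
      | zero => rw [hQ0]
      | succ j =>
        by_cases h : Q (j + 1) = extz p (j + 1)
        · rw [h]
        · rw [hw, hw, hfQ j hj h]; simp
    rw [h1, abel_sum Q w hw0, hQJ, zero_mul, add_zero, ← Finset.sum_neg_distrib]
    refine Finset.sum_congr rfl fun j hj => ?_
    rw [← hfQφ j (Finset.mem_range.1 hj), hw]; ring
  rw [hsum, Finset.sum_range] at hpv
  obtain ⟨h, hh⟩ : ∃ h : Fin J → ℝ, ∀ j : Fin J, h j = max (Q ((j : ℕ) + 1) - Q j) 0 :=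
    ⟨_, fun _ => rfl⟩
  have hh0 : ∀ j, 0 ≤ h j := fun j => by rw [hh]; exact le_max_right _ _
  have key := main_ineq lam c μ β h hlam hc hμ hβ hh0 (by
    have : ∑ i, h i * (1 / β i) ≤ ∑ i : Fin J, φ i * max (Q ((i : ℕ) + 1) - Q i) 0 := by
      refine Finset.sum_le_sum fun i _ => ?_
      rw [← hh, mul_comm]
      exact mul_le_mul_of_nonneg_right (hφβ i) (hh0 i)
    linarith)
  refine key.trans ?_
  unfold Ham
  have hG : -(p 0) ≤ ∑ i, h i := by
    have h1 : ∑ i : Fin J, (Q ((i : ℕ) + 1) - Q i) ≤ ∑ i, h i :=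
      Finset.sum_le_sum fun i _ => by rw [hh]; exact le_max_left _ _
    have h2 : ∑ i : Fin J, (Q ((i : ℕ) + 1) - Q i) = Q J - Q 0 := by
      rw [← Finset.sum_range (fun i => Q (i + 1) - Q i), Finset.sum_range_sub]
    have h3 : extz p 0 = p 0 := by simp [extz, NeZero.pos J]
    rw [hQJ, hQ0, h3] at h2
    linarith
  have h1 := mul_le_mul_of_nonneg_left (Real.exp_le_exp.2 hG) hlam.le
  have h2 : ∑ i, μ i * (1 - Real.exp (-(h i)))
      ≤ ∑ i, max 0 (μ i * (1 - Real.exp (dotJ (gam J i) p))) := by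
    refine Finset.sum_le_sum fun i _ => ?_
    rw [dotJ_comm, dotJ_gam]
    have h3 : h i ≤ max (extz p (i + 1) - extz p i) 0 := by
      rw [hh]; exact max_le (hQP i) (le_max_right _ _)
    rcases le_total (extz p (i + 1) - extz p i) 0 with h4 | h4
    · rw [max_eq_right h4] at h3
      have : h i = 0 := le_antisymm h3 (hh0 i)
      rw [this]; simp
    · rw [max_eq_left h4] at h3
      refine le_max_of_le_right (mul_le_mul_of_nonneg_left ?_ (hμ i).le)
      have := Real.exp_le_exp.2 (show extz p i - extz p (i + 1) ≤ -(h i) by linarith)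
      linarith
  linarith

/-- `V(x) = min_i b_i·(z−x)` is Lipschitz on the closure of `G`, vanishes on
`∂_o G`, and is a viscosity solution of the PDE. -/
theorem stmt0 (J : ℕ) [NeZero J] (lam c : ℝ) (μ z β : Fin J → ℝ)
    (hlam : 0 < lam) (hc : 0 < c) (hμ : ∀ i, 0 < μ i) (hz : ∀ i, 0 < z i)
    (hβ : ∀ i, 0 < β i ∧
      c + lam * (1 - Real.exp (β i)) + μ i * (1 - Real.exp (-(β i))) = 0) :
    (∃ K : NNReal, LipschitzOnWith K
        (fun x => ⨅ i, dotJ (bvec β i) (z - x)) (closure (domG z))) ∧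
    (∀ x ∈ bdO z, (⨅ i, dotJ (bvec β i) (z - x)) = 0) ∧
    (∀ x ∈ domG z,
      ∀ p ∈ supDiff (domG z) (fun y => ⨅ i, dotJ (bvec β i) (z - y)) x,
        0 ≤ Ham lam c μ p ∨ ∃ i : Fin J, x i = 0 ∧ 0 ≤ dotJ p (gam J i)) ∧
    (∀ x ∈ domG z \ bdC z,
      ∀ p ∈ subDiff (domG z) (fun y => ⨅ i, dotJ (bvec β i) (z - y)) x,
        Ham lam c μ p ≤ 0 ∨ ∃ i : Fin J, x i = 0 ∧ dotJ p (gam J i) ≤ 0) := by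
  obtain ⟨K, hK⟩ := V_lip β z
  exact ⟨⟨K, hK.lipschitzOnWith⟩, V_bd β z (fun i => (hβ i).1),
    sup_part lam c μ z β hlam hc hμ hz hβ, sub_part lam c μ z β hμ hz hβ⟩
end
end

section
/- For every x ∈ G, the minimum defining V may be restricted to the index set A(x): min_{1≤i≤J} b_i·(z−x) = min_{i∈A(x)} b_i·(z−x). -/
open Real

noncomputable section

/-- Larger service rates give larger roots. -/
theorem beta_mono_aux {lam c m n a b : ℝ} (hlam : 0 < lam) (hc : 0 < c) (hm : 0 < m)
    (ha : 0 < a) (hb : 0 < b)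
    (h1 : c + lam * (1 - Real.exp a) + m * (1 - Real.exp (-a)) = 0)
    (h2 : c + lam * (1 - Real.exp b) + n * (1 - Real.exp (-b)) = 0)
    (hmn : m ≤ n) : a ≤ b := by
  by_contra hab
  push Not at hab
  have hE : Real.exp b < Real.exp a := Real.exp_lt_exp.mpr hab
  have hb1 : 1 < Real.exp b := Real.one_lt_exp_iff.mpr hb
  rw [Real.exp_neg] at h1 h2
  generalize Real.exp a = A at *
  generalize Real.exp b = B at *
  have hA0 : 0 < A := by linarith
  have hB0 : 0 < B := by linarith
  have e1 : (A - 1) * (lam - m / A) = c := by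
    field_simp at h1 ⊢; linarith
  have e2 : (B - 1) * (lam - n / B) = c := by
    field_simp at h2 ⊢; linarith
  have h3 : m / A < n / B := by
    rw [div_lt_div_iff₀ hA0 hB0]; nlinarith
  have h4 : 0 < lam - n / B := by
    by_contra h; push Not at h; nlinarith
  nlinarith

theorem dot_bvec_aux {J : ℕ} (β w : Fin J → ℝ) (i : Fin J) :
    dotJ (bvec β i) w = β i * ∑ j ∈ Finset.univ.filter (fun j => j ≤ i), w j := by
  unfold dotJ bvec
  rw [Finset.mul_sum, Finset.sum_filter]
  refine Finset.sum_congr rfl fun j _ => ?_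
  by_cases h : j ≤ i
  · have h' : (j : ℕ) ≤ i := h
    simp [h, h']
  · have h' : ¬ (j : ℕ) ≤ i := h
    simp [h, h']

/-- the minimum defining `V` may be restricted to the index set `A(x)`:
the global minimum `⨅ i, b_i·(z−x)` is attained on `A(x)` and bounds all values there. -/
theorem stmt2 (J : ℕ) [NeZero J] (lam c : ℝ) (μ z β : Fin J → ℝ)
    (hlam : 0 < lam) (hc : 0 < c) (hμ : ∀ i, 0 < μ i) (hz : ∀ i, 0 < z i)
    (hβ : ∀ i, 0 < β i ∧
      c + lam * (1 - Real.exp (β i)) + μ i * (1 - Real.exp (-(β i))) = 0)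
    (x : Fin J → ℝ) (hx : x ∈ domG z) :
    IsLeast ((fun i => dotJ (bvec β i) (z - x)) '' Aset μ z x)
      (⨅ i, dotJ (bvec β i) (z - x)) := by
  classical
  obtain ⟨hx0, hx1, hx2⟩ := hx
  have hw : ∀ j, 0 ≤ (z - x) j := by
    intro j
    by_cases h : j = 0
    · subst h; simp [hx1.le]
    · simp [hx2 j h]
  set f : Fin J → ℝ := fun i => dotJ (bvec β i) (z - x) with hf
  have hbm : ∀ i j, μ i ≤ μ j → β i ≤ β j := fun i j h =>
    beta_mono_aux hlam hc (hμ i) (hβ i).1 (hβ j).1 (hβ i).2 (hβ j).2 h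
  set S : Fin J → ℝ := fun i => ∑ j ∈ Finset.univ.filter (fun j => j ≤ i), (z - x) j with hS
  have hfS : ∀ i, f i = β i * S i := fun i => dot_bvec_aux β (z - x) i
  have hS0 : ∀ i, 0 ≤ S i := fun i => Finset.sum_nonneg fun j _ => hw j
  have hSm : ∀ i j, i ≤ j → S i ≤ S j := by
    intro i j hij
    refine Finset.sum_le_sum_of_subset_of_nonneg ?_ fun k _ _ => hw k
    intro k hk
    simp only [Finset.mem_filter, Finset.mem_univ, true_and] at hk ⊢
    exact hk.trans hij
  obtain ⟨i, hi⟩ := Finite.exists_min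
    (fun i : Fin J => toLex (f i, toLex (μ i, OrderDual.toDual i)))
  have key : ∀ j, f j ≤ f i → μ j ≤ μ i → f j = f i ∧ μ j = μ i ∧ j ≤ i := by
    intro j h1 h2
    have := hi j
    simp only [Prod.Lex.toLex_le_toLex, OrderDual.toDual_le_toDual] at this
    rcases this with h | ⟨h, h' | ⟨h', h''⟩⟩
    · exact absurd h (not_lt.mpr h1)
    · exact absurd h' (not_lt.mpr h2)
    · exact ⟨h.symm, h'.symm, h''⟩
  have hmin : ∀ j, f i ≤ f j := by
    intro j
    have := hi j
    simp only [Prod.Lex.toLex_le_toLex] at this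
    rcases this with h | ⟨h, -⟩
    · exact h.le
    · exact h.le
  have hinf : (⨅ i, f i) = f i :=
    le_antisymm (ciInf_le (Set.finite_range f).bddBelow i) (le_ciInf hmin)
  change IsLeast (f '' Aset μ z x) (⨅ i, f i)
  rw [hinf]
  refine ⟨⟨i, ⟨?_, Or.inr ?_⟩, rfl⟩, ?_⟩
  · intro j hj
    by_contra h
    push Not at h
    have : f j ≤ f i := by
      rw [hfS, hfS]
      exact mul_le_mul (hbm _ _ h.le) (hSm _ _ hj.le) (hS0 _) (hβ i).1.le
    exact h.ne (key j this h.le).2.1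
  · intro j hj hk
    by_contra h
    push Not at h
    have hSS : S i = S j := by
      refine Finset.sum_subset ?_ ?_
      · intro k hk
        simp only [Finset.mem_filter, Finset.mem_univ, true_and] at hk ⊢
        exact hk.trans hj.le
      · intro k h1 h2
        simp only [Finset.mem_filter, Finset.mem_univ, true_and, not_le] at h1 h2
        simp [hk k h2 h1]
    have : f j ≤ f i := by
      rw [hfS, hfS, hSS]
      exact mul_le_mul_of_nonneg_right (hbm _ _ h) (hS0 _)
    exact absurd hj (not_lt.mpr (key j this h).2.2)
  · rintro _ ⟨j, -, rfl⟩
    exact hmin j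
end
end

section
/- Let y ∈ ℝ^J satisfy y_i ≥ 0 for all i and y_1 > 0. If an index j satisfies β_j(y_1 + ⋯ + y_j) ≤ β_i(y_1 + ⋯ + y_i) for every i ≠ j, then j ∈ A', i.e., μ_j ≤ μ_l for every l < j. (Thus only indices in A' can be bottlenecks.) -/
open Real

noncomputable section

/-- only indices in `A'` can be bottlenecks: if `y ≥ 0`, `y_1 > 0` and
`β_j(y_1+⋯+y_j) ≤ β_i(y_1+⋯+y_i)` for all `i ≠ j`, then `μ_j ≤ μ_l` for all `l < j`. -/
theorem stmt3 (J : ℕ) [NeZero J] (lam c : ℝ) (μ β : Fin J → ℝ)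
    (hlam : 0 < lam) (hc : 0 < c) (hμ : ∀ i, 0 < μ i)
    (hβ : ∀ i, 0 < β i ∧
      c + lam * (1 - Real.exp (β i)) + μ i * (1 - Real.exp (-(β i))) = 0)
    (y : Fin J → ℝ) (hy : ∀ i, 0 ≤ y i) (hy1 : 0 < y 0)
    (j : Fin J)
    (hmin : ∀ i : Fin J, i ≠ j →
      β j * (∑ k ∈ Finset.univ.filter (fun k : Fin J => (k : ℕ) ≤ (j : ℕ)), y k) ≤
      β i * (∑ k ∈ Finset.univ.filter (fun k : Fin J => (k : ℕ) ≤ (i : ℕ)), y k)) :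
    ∀ l : Fin J, l < j → μ j ≤ μ l := by
  intro l hl
  have hsub : (∑ k ∈ Finset.univ.filter (fun k : Fin J => (k : ℕ) ≤ (l : ℕ)), y k) ≤
      ∑ k ∈ Finset.univ.filter (fun k : Fin J => (k : ℕ) ≤ (j : ℕ)), y k := by
    apply Finset.sum_le_sum_of_subset_of_nonneg
    · intro k hk
      simp only [Finset.mem_filter, Finset.mem_univ, true_and] at hk ⊢
      exact hk.trans (le_of_lt hl)
    · intro k _ _
      exact hy k
  have hpos : 0 < ∑ k ∈ Finset.univ.filter (fun k : Fin J => (k : ℕ) ≤ (j : ℕ)), y k := by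
    refine lt_of_lt_of_le hy1 ?_
    apply Finset.single_le_sum (f := y) (fun k _ => hy k)
    simp
  have hm := hmin l (ne_of_lt hl)
  have hb : β j ≤ β l := by
    have h2 := mul_le_mul_of_nonneg_left hsub (hβ l).1.le
    exact le_of_mul_le_mul_right (hm.trans h2) hpos
  have key : ∀ i, μ i = lam * Real.exp (β i) - c - c / (Real.exp (β i) - 1) := by
    intro i
    obtain ⟨h0, h1⟩ := hβ i
    have hx : 1 < Real.exp (β i) := Real.one_lt_exp_iff.mpr h0
    rw [Real.exp_neg] at h1
    generalize Real.exp (β i) = x at h1 hx ⊢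
    have hx0 : x ≠ 0 := by linarith
    have hx1 : x - 1 ≠ 0 := by linarith
    field_simp at h1 ⊢
    linarith
  rw [key j, key l]
  have hx : 1 < Real.exp (β j) := Real.one_lt_exp_iff.mpr (hβ j).1
  have hxz := Real.exp_le_exp.mpr hb
  have h3 : c / (Real.exp (β l) - 1) ≤ c / (Real.exp (β j) - 1) :=
    div_le_div_of_nonneg_left hc.le (by linarith) (by linarith)
  have h4 := mul_le_mul_of_nonneg_left hxz hlam.le
  linarith
end
end

section
/- The positive roots β_i are strictly increasing in the service rates: for any indices i, j, one has μ_i < μ_j if and only if β_i < β_j (consequently μ_i ≤ μ_j if and only if β_i ≤ β_j). -/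
open Real

noncomputable section

/-- the roots `β_i` are strictly increasing in the service rates:
`μ_i < μ_j ↔ β_i < β_j`, and consequently `μ_i ≤ μ_j ↔ β_i ≤ β_j`. -/
theorem stmt6 (J : ℕ) (lam c : ℝ) (μ β : Fin J → ℝ)
    (hlam : 0 < lam) (hc : 0 < c) (hμ : ∀ i, 0 < μ i)
    (hβ : ∀ i, 0 < β i ∧
      c + lam * (1 - Real.exp (β i)) + μ i * (1 - Real.exp (-(β i))) = 0)
    (i j : Fin J) :
    (μ i < μ j ↔ β i < β j) ∧ (μ i ≤ μ j ↔ β i ≤ β j) := by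
  have key : ∀ k, μ k = lam * exp (β k) - c - c / (exp (β k) - 1) := by
    intro k
    obtain ⟨h0, h1⟩ := hβ k
    have hx : 1 < exp (β k) := Real.one_lt_exp_iff.mpr h0
    rw [Real.exp_neg] at h1
    have h2 : exp (β k) - 1 ≠ 0 := by linarith
    have h3 : exp (β k) ≠ 0 := (Real.exp_pos _).ne'
    generalize exp (β k) = x at *
    field_simp at h1 ⊢
    linarith
  have mono : ∀ k l, β k < β l → μ k < μ l := by
    intro k l h
    have hx : 1 < exp (β k) := Real.one_lt_exp_iff.mpr (hβ k).1
    have hxy : exp (β k) < exp (β l) := Real.exp_lt_exp.mpr h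
    rw [key k, key l]
    have h1 : c / (exp (β l) - 1) < c / (exp (β k) - 1) :=
      div_lt_div_of_pos_left hc (by linarith) (by linarith)
    have h2 := mul_lt_mul_of_pos_left hxy hlam
    linarith
  have heq : β i = β j → μ i = μ j := by
    intro h
    rw [key i, key j, h]
  rcases lt_trichotomy (β i) (β j) with h | h | h
  · have := mono _ _ h
    exact ⟨iff_of_true this h, iff_of_true this.le h.le⟩
  · have := heq h
    exact ⟨iff_of_false this.not_lt h.not_lt, iff_of_true this.le h.le⟩
  · have := mono _ _ h
    exact ⟨iff_of_false this.not_gt h.not_gt, iff_of_false this.not_ge h.not_ge⟩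
end
end

section
/- For every p ∈ ℝ^J, the Hamiltonian H(p) = sup_{u∈U} inf_{m∈M} H(p,u,m) has the closed form H(p) = c + λ(1 − e^{−p_1}) + Σ_{i=1}^J max(0, μ_i(1 − e^{γ_i·p})). -/
open Real

noncomputable section

theorem aux_lower (a q x : ℝ) (ha : 0 < a) (hx : 0 ≤ x) :
    a * (1 - Real.exp (-q)) ≤ q * x + a * lfun (x / a) := by
  obtain ⟨t, rfl⟩ : ∃ t, x = a * t := ⟨x / a, by field_simp⟩
  have ht : 0 ≤ t := by
    by_contra h
    push Not at h
    nlinarith [mul_neg_of_pos_of_neg ha h]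
  have e : a * t / a = t := by field_simp
  rw [e]
  unfold lfun
  suffices h : 0 ≤ t * Real.log t + q * t - t + Real.exp (-q) by
    nlinarith [mul_nonneg ha.le h]
  rcases ht.eq_or_lt with h0 | h0
  · rw [← h0]; simp; positivity
  · have h1 : Real.exp (-q) = t * Real.exp (-(q + Real.log t)) := by
      rw [neg_add, Real.exp_add, Real.exp_neg (Real.log t), Real.exp_log h0]
      field_simp
    have h2 := Real.add_one_le_exp (-(q + Real.log t))
    rw [h1]
    nlinarith [mul_le_mul_of_nonneg_left h2 ht]

theorem aux_eq (a q : ℝ) (ha : 0 < a) :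
    q * (a * Real.exp (-q)) + a * lfun (a * Real.exp (-q) / a) = a * (1 - Real.exp (-q)) := by
  have e : a * Real.exp (-q) / a = Real.exp (-q) := by field_simp
  rw [e]
  unfold lfun
  rw [Real.log_exp]
  ring

theorem aux_form {J : ℕ} [NeZero J] (lam c : ℝ) (μ : Fin J → ℝ) (p u : Fin J → ℝ)
    (m : ℝ × (Fin J → ℝ)) :
    Hpum lam c μ p u m = c + (p 0 * m.1 + lam * lfun (m.1 / lam)) +
      ∑ i, u i * ((-dotJ (gam J i) p) * m.2 i + μ i * lfun (m.2 i / μ i)) := by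
  have h : dotJ p (fun j => m.1 * (if j = 0 then 1 else 0) - ∑ i, u i * m.2 i * gam J i j)
      = p 0 * m.1 + ∑ i, u i * ((-dotJ (gam J i) p) * m.2 i) := by
    have h2 : ∑ i, u i * ((-dotJ (gam J i) p) * m.2 i)
        = - ∑ j, p j * ∑ i, u i * m.2 i * gam J i j := by
      simp only [dotJ, Finset.mul_sum]
      rw [Finset.sum_comm, ← Finset.sum_neg_distrib]
      refine Finset.sum_congr rfl fun i _ => ?_
      rw [← Finset.sum_neg_distrib, Finset.sum_mul, ← Finset.sum_neg_distrib, Finset.mul_sum]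
      refine Finset.sum_congr rfl fun j _ => ?_
      ring
    rw [h2]
    simp only [dotJ, mul_sub, Finset.sum_sub_distrib]
    simp [sub_eq_add_neg]
  unfold Hpum
  rw [h]
  simp only [mul_add, Finset.sum_add_distrib]
  ring

theorem aux_inf {J : ℕ} [NeZero J] (lam c : ℝ) (μ : Fin J → ℝ)
    (hlam : 0 < lam) (hμ : ∀ i, 0 < μ i) (p u : Fin J → ℝ) (hu : u ∈ Uset J) :
    sInf ((fun m => Hpum lam c μ p u m) '' Mset J) =
      c + lam * (1 - Real.exp (-(p 0))) +
        ∑ i, u i * (μ i * (1 - Real.exp (dotJ (gam J i) p))) := by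
  apply IsLeast.csInf_eq
  constructor
  · refine ⟨(lam * Real.exp (-(p 0)), fun i => μ i * Real.exp (- -dotJ (gam J i) p)),
      ⟨by positivity, fun i => mul_nonneg (hμ i).le (Real.exp_pos _).le⟩, ?_⟩
    simp only [aux_form]
    rw [aux_eq _ _ hlam]
    congr 1
    refine Finset.sum_congr rfl fun i _ => ?_
    rw [aux_eq _ _ (hμ i), neg_neg]
  · rintro _ ⟨m, hm, rfl⟩
    simp only [aux_form]
    have h1 := aux_lower lam (p 0) m.1 hlam hm.1
    have h2 : ∑ i, u i * (μ i * (1 - Real.exp (dotJ (gam J i) p))) ≤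
        ∑ i, u i * ((-dotJ (gam J i) p) * m.2 i + μ i * lfun (m.2 i / μ i)) := by
      refine Finset.sum_le_sum fun i _ => mul_le_mul_of_nonneg_left ?_ (hu i).1
      have := aux_lower (μ i) (-dotJ (gam J i) p) (m.2 i) (hμ i) (hm.2 i)
      rwa [neg_neg] at this
    linarith

/-- the closed form of the Hamiltonian:
`sup_{u∈U} inf_{m∈M} H(p,u,m) = c + λ(1 − e^{−p_1}) + Σ_i max(0, μ_i(1 − e^{γ_i·p}))`. -/
theorem stmt10 (J : ℕ) [NeZero J] (lam c : ℝ) (μ : Fin J → ℝ)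
    (hlam : 0 < lam) (hc : 0 < c) (hμ : ∀ i, 0 < μ i) (p : Fin J → ℝ) :
    sSup ((fun u => sInf ((fun m => Hpum lam c μ p u m) '' Mset J)) '' Uset J) =
      Ham lam c μ p := by
  apply IsGreatest.csSup_eq
  constructor
  · have hu : (fun i => if 0 ≤ μ i * (1 - Real.exp (dotJ (gam J i) p)) then (1 : ℝ) else 0)
        ∈ Uset J := by
      intro i
      dsimp only
      split_ifs <;> norm_num
    refine ⟨_, hu, ?_⟩
    dsimp only
    rw [aux_inf lam c μ hlam hμ p _ hu]
    unfold Ham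
    congr 1
    refine Finset.sum_congr rfl fun i _ => ?_
    split_ifs with h
    · rw [max_eq_right h, one_mul]
    · rw [max_eq_left (not_le.mp h).le, zero_mul]
  · rintro _ ⟨u, hu, rfl⟩
    dsimp only
    rw [aux_inf lam c μ hlam hμ p u hu]
    unfold Ham
    gcongr with i
    rcases le_total 0 (μ i * (1 - Real.exp (dotJ (gam J i) p))) with h | h
    · exact le_max_of_le_right (mul_le_of_le_one_left h (hu i).2)
    · exact le_max_of_le_left (mul_nonpos_of_nonneg_of_nonpos (hu i).1 h)
end
end

section
/- Let x ∈ G, I = I(x), B = B(x), A = A(x), and let S be the associated constraint set. Every extreme point (ν, δ) of the convex set S has the following form: ν = e_k (the k-th unit vector) for some k ∈ A, and δ = δ^{(r,k)} for some integer r with s ≤ r ≤ t−1, where s is the largest index j ≤ k with j ∉ I (and s = 0 if no such j exists), t is the least index j ∈ {k+1,…,J} with j ∉ B (and t = J+1 if no such j exists), and δ^{(r,k)}_i = β_k(1_{i ≥ r+1} − 1_{i ≥ k+1}) for i = 1,…,J, with δ^{(r,k)}_{J+1} = 0. -/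
open Real

noncomputable section

lemma aux_r (J : ℕ) (d w : ℕ → ℝ) (k : ℕ) (hk : k < J) (hwk : 0 < w k)
    (hw : ∀ i < J, 0 ≤ w i) (hd : d J = 0) :
    ∃ r ≤ J, (∀ m, r ≤ m → m ≤ k → 0 < d m) ∧ (∀ m, k < m → m < r → d m < 0) ∧
      (∀ i, i + 1 = r → 0 < w i - d i + d (i + 1)) := by
  classical
  by_cases h : 0 < d k
  · have hex : ∃ r, ∀ m, r ≤ m → m ≤ k → 0 < d m := by
      refine ⟨k, fun m h1 h2 => ?_⟩
      have : m = k := le_antisymm h2 h1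
      rwa [this]
    have hspec := Nat.find_spec hex
    have hle : Nat.find hex ≤ k := Nat.find_min' hex (fun m h1 h2 => by
      have : m = k := le_antisymm h2 h1
      rwa [this])
    refine ⟨Nat.find hex, by omega, hspec, fun m h1 h2 => by omega, fun i hi => ?_⟩
    have hmin := Nat.find_min hex (m := i) (by omega)
    have hdi : d i ≤ 0 := by
      by_contra hcon
      apply hmin
      intro m h1 h2
      rcases Nat.eq_or_lt_of_le h1 with h3 | h3
      · rw [← h3]; linarith
      · exact hspec m (by omega) h2
    have h1 := hspec (i + 1) (by omega) (by omega)
    have h2 := hw i (by omega)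
    linarith
  · have hex : ∃ r, k < r ∧ 0 ≤ d r := ⟨J, hk, hd.ge⟩
    have hspec := Nat.find_spec hex
    have hle : Nat.find hex ≤ J := Nat.find_min' hex ⟨hk, hd.ge⟩
    refine ⟨Nat.find hex, hle, fun m h1 h2 => by omega, fun m h1 h2 => ?_, fun i hi => ?_⟩
    · have := Nat.find_min hex h2
      by_contra hcon
      exact this ⟨h1, by linarith⟩
    · have h2 := hspec.2
      rw [← hi] at h2
      rcases Nat.eq_or_lt_of_le (show k ≤ i by omega) with h3 | h3
      · rw [← h3] at h2 ⊢
        linarith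
      · have h4 := Nat.find_min hex (m := i) (by omega)
        have h5 : d i < 0 := by
          by_contra hcon
          exact h4 ⟨h3, by linarith⟩
        have := hw i (by omega)
        linarith

lemma aux_eps {ι : Type*} [Finite ι] (f : ι → ℝ) :
    ∃ ε > 0, ∀ i, 0 < f i → ε ≤ f i := by
  have h : ∀ i, ∃ ε > 0, ∀ e ≤ ε, 0 < f i → e ≤ f i := by
    intro i
    by_cases hi : 0 < f i
    · exact ⟨f i, hi, fun e he _ => he⟩
    · exact ⟨1, one_pos, fun e _ h => absurd h hi⟩
  choose g hg hg' using h
  rcases isEmpty_or_nonempty ι with hι | hι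
  · exact ⟨1, one_pos, fun i => (hι.false i).elim⟩
  · obtain ⟨i0, hi0⟩ := Finite.exists_min g
    exact ⟨g i0, hg i0, fun i => hg' i _ (hi0 i)⟩

/-- every extreme point of `S` has the form `ν = e_k` for some `k ∈ A(x)`
and `δ = δ^{(r,k)}` for some `r` with `s ≤ r ≤ t − 1`. -/
theorem stmt14 (J : ℕ) [NeZero J] (lam c : ℝ) (μ z β : Fin J → ℝ)
    (hlam : 0 < lam) (hc : 0 < c) (hμ : ∀ i, 0 < μ i) (hz : ∀ i, 0 < z i)
    (hβ : ∀ i, 0 < β i ∧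
      c + lam * (1 - Real.exp (β i)) + μ i * (1 - Real.exp (-(β i))) = 0)
    (x : Fin J → ℝ) (hx : x ∈ domG z) :
    ∀ q ∈ Set.extremePoints ℝ (Sset μ β z x),
      ∃ k ∈ Aset μ z x, ∃ r : ℕ, sIdx x k ≤ r ∧ r + 1 ≤ tIdx z x k ∧
        q.1 = (fun i => if i = k then (1 : ℝ) else 0) ∧
        q.2 = delrk β k r := by
  intro q hq
  rw [mem_extremePoints_iff_left] at hq
  obtain ⟨hqS, hext⟩ := hq
  have hqS' := hqS
  obtain ⟨hJ, hI, hB, hN, hA, hA', hsum, hsl⟩ := hqS'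
  have hν : ∀ i, 0 ≤ q.1 i := fun i => by
    by_cases h : i ∈ Aset μ z x
    · exact hA i h
    · exact (hA' i h).ge
  obtain ⟨k, hk⟩ : ∃ k, 0 < q.1 k := by
    by_contra hcon
    push Not at hcon
    have : ∑ i, q.1 i ≤ 0 := Finset.sum_nonpos (fun i _ => hcon i)
    linarith
  have hkA : k ∈ Aset μ z x := by
    by_contra h
    have := hA' k h
    linarith
  have hbk := (hβ k).1
  -- sign constraints
  have hpos : ∀ i : Fin J, 0 < q.2 i.castSucc → x i = 0 := by
    intro i h
    by_contra h0
    by_cases h1 : x i = z i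
    · linarith [hB i h1]
    · linarith [hN i h0 h1]
  have hneg : ∀ i : Fin J, q.2 i.castSucc < 0 → x i = z i := by
    intro i h
    by_contra h1
    by_cases h0 : x i = 0
    · linarith [hI i h0]
    · linarith [hN i h0 h1]
  obtain ⟨r, hrJ, hr1, hr2, hr3⟩ := aux_r J
    (fun n => if h : n < J + 1 then q.2 ⟨n, h⟩ else 0)
    (fun n => if h : n < J then q.1 ⟨n, h⟩ * β ⟨n, h⟩ else 0) k k.2
    (by simp only [k.2, dite_true]; exact mul_pos hk hbk)
    (by intro i hi; simp only [hi, dite_true]; exact mul_nonneg (hν _) (hβ _).1.le)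
    (by simpa [Fin.last] using hJ)
  have hP : ∀ m : Fin (J + 1), r ≤ m → (m : ℕ) ≤ k → 0 < q.2 m := by
    intro m h1 h2
    simpa [m.2] using hr1 m h1 h2
  have hM : ∀ m : Fin (J + 1), (k : ℕ) < m → (m : ℕ) < r → q.2 m < 0 := by
    intro m h1 h2
    simpa [m.2] using hr2 m h1 h2
  have hU : ∀ i : Fin J, (i : ℕ) + 1 = r → 0 < q.1 i * β i - q.2 i.castSucc + q.2 i.succ := by
    intro i h
    have h3 := hr3 i h
    have hi1 : (i : ℕ) < J + 1 := by omega
    simp only [i.2, hi1, dite_true, Nat.add_lt_add_iff_right] at h3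
    exact h3
  clear hr1 hr2 hr3
  refine ⟨k, hkA, r, ?_, ?_, ?_⟩
  · unfold sIdx
    apply csSup_le ⟨0, Set.mem_insert _ _⟩
    rintro b (rfl | ⟨j, ⟨hjk, hj⟩, rfl⟩)
    · omega
    · by_contra hcon
      simp only [not_le] at hcon
      exact hj (hpos j (hP _ (by simp; omega) (by simpa using hjk)))
  · unfold tIdx
    apply le_csInf ⟨J + 1, Set.mem_insert _ _⟩
    rintro b (rfl | ⟨j, ⟨hjk, hj⟩, rfl⟩)
    · omega
    · by_contra hcon
      simp only [not_le] at hcon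
      exact hj (hneg j (hM _ (by simpa using hjk) (by simp; omega)))
  -- the candidate point
  have hdel : ∀ m : Fin (J + 1), (delrk β k r m = β k ∧ 0 < q.2 m) ∨
      (delrk β k r m = -β k ∧ q.2 m < 0) ∨ delrk β k r m = 0 := by
    intro m
    unfold delrk
    by_cases h1 : r ≤ (m : ℕ) <;> by_cases h2 : (k : ℕ) + 1 ≤ (m : ℕ)
    · right; right; simp [h1, h2]
    · left; exact ⟨by simp [h1, h2], hP m h1 (by omega)⟩
    · right; left; exact ⟨by simp [h1, h2], hM m (by omega) (by omega)⟩
    · right; right; simp [h1, h2]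
  have hdU : ∀ i : Fin J, (if i = k then (1 : ℝ) else 0) * β i - delrk β k r i.castSucc
      + delrk β k r i.succ = if (i : ℕ) + 1 = r then β k else 0 := by
    intro i
    have hik : (i = k) ↔ (i : ℕ) = k := Fin.ext_iff
    by_cases e : i = k
    · subst e
      unfold delrk
      simp only [Fin.val_castSucc, Fin.val_succ]
      split_ifs <;> first | omega | (simp at *; done) | ring
    · have e' : (i : ℕ) ≠ k := fun h => e (hik.2 h)
      unfold delrk
      simp only [Fin.val_castSucc, Fin.val_succ, e, if_false]
      split_ifs <;> first | omega | ring
  have hdJ : delrk β k r (Fin.last J) = 0 := by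
    unfold delrk
    have : (k : ℕ) + 1 ≤ J := k.2
    simp [hrJ, this]
  obtain ⟨ε1, he1, hε1⟩ := aux_eps q.2
  obtain ⟨ε2, he2, hε2⟩ := aux_eps (fun m => -q.2 m)
  obtain ⟨ε3, he3, hε3⟩ := aux_eps
    (fun i : Fin J => q.1 i * β i - q.2 i.castSucc + q.2 i.succ)
  obtain ⟨ε, he, hε1', hεk, hεa, hεb, hεc⟩ : ∃ ε > 0, ε < 1 ∧ ε ≤ q.1 k ∧ ε * β k ≤ ε1 ∧
      ε * β k ≤ ε2 ∧ ε * β k ≤ ε3 := by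
    refine ⟨min (1/2) (min (q.1 k) (min (ε1 / β k) (min (ε2 / β k) (ε3 / β k)))),
      ?_, ?_, ?_, ?_, ?_, ?_⟩
    · have := div_pos he1 hbk
      have := div_pos he2 hbk
      have := div_pos he3 hbk
      simp only [gt_iff_lt, lt_min_iff]
      exact ⟨by norm_num, hk, by assumption, by assumption, by assumption⟩
    · exact lt_of_le_of_lt (min_le_left _ _) (by norm_num)
    · simp
    all_goals
      rw [← le_div_iff₀ hbk]
      simp
  have h1ε : 0 < 1 - ε := by linarith
  set p : (Fin J → ℝ) × (Fin (J + 1) → ℝ) :=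
    (fun i => if i = k then (1 : ℝ) else 0, delrk β k r) with hp
  have hpS : p ∈ Sset μ β z x := by
    refine ⟨hdJ, ?_, ?_, ?_, ?_, ?_, ?_, ?_⟩
    · intro i hi
      rcases hdel i.castSucc with ⟨h, _⟩ | ⟨_, h⟩ | h
      · exact hbk.le.trans h.ge
      · linarith [hI i hi]
      · exact h.ge
    · intro i hi
      rcases hdel i.castSucc with ⟨_, h⟩ | ⟨h, _⟩ | h
      · linarith [hB i hi]
      · show delrk β k r i.castSucc ≤ 0
        linarith
      · exact h.le
    · intro i h0 h1
      have := hN i h0 h1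
      rcases hdel i.castSucc with ⟨_, h⟩ | ⟨_, h⟩ | h
      · linarith
      · linarith
      · exact h
    · intro i _
      show (0 : ℝ) ≤ if i = k then (1 : ℝ) else 0
      split_ifs <;> norm_num
    · intro i hi
      exact if_neg (fun h : i = k => hi (by rw [h]; exact hkA))
    · simp [hp]
    · intro i
      have h := hdU i
      show -((if i = k then (1 : ℝ) else 0) * β i) + delrk β k r i.castSucc
        - delrk β k r i.succ ≤ 0
      have : (0 : ℝ) ≤ if (i : ℕ) + 1 = r then β k else 0 := by
        split_ifs
        · exact hbk.le
        · exact le_rfl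
      linarith
  have hinv : 0 < (1 - ε)⁻¹ := inv_pos.2 h1ε
  have hq'S : (1 - ε)⁻¹ • (q - ε • p) ∈ Sset μ β z x := by
    refine ⟨?_, ?_, ?_, ?_, ?_, ?_, ?_, ?_⟩
    · show (1 - ε)⁻¹ * (q.2 (Fin.last J) - ε * delrk β k r (Fin.last J)) = 0
      rw [hJ, hdJ]; ring
    · intro i hi
      show 0 ≤ (1 - ε)⁻¹ * (q.2 i.castSucc - ε * delrk β k r i.castSucc)
      apply mul_nonneg hinv.le
      have h2 := hI i hi
      rcases hdel i.castSucc with ⟨h, h'⟩ | ⟨h, h'⟩ | h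
      · rw [h]; linarith [hε1 _ h']
      · linarith
      · rw [h]; linarith
    · intro i hi
      show (1 - ε)⁻¹ * (q.2 i.castSucc - ε * delrk β k r i.castSucc) ≤ 0
      apply mul_nonpos_of_nonneg_of_nonpos hinv.le
      have h2 := hB i hi
      rcases hdel i.castSucc with ⟨h, h'⟩ | ⟨h, h'⟩ | h
      · linarith
      · have h3 := hε2 i.castSucc (by linarith)
        rw [h]; linarith
      · rw [h]; linarith
    · intro i h0 h1
      show (1 - ε)⁻¹ * (q.2 i.castSucc - ε * delrk β k r i.castSucc) = 0
      have h2 := hN i h0 h1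
      have h3 : delrk β k r i.castSucc = 0 := hpS.2.2.2.1 i h0 h1
      rw [h2, h3]; ring
    · intro i _
      show 0 ≤ (1 - ε)⁻¹ * (q.1 i - ε * (if i = k then (1 : ℝ) else 0))
      apply mul_nonneg hinv.le
      by_cases h : i = k
      · subst h; simp; linarith
      · simp [h, hν i]
    · intro i hi
      show (1 - ε)⁻¹ * (q.1 i - ε * (if i = k then (1 : ℝ) else 0)) = 0
      rw [hA' i hi, if_neg (fun h : i = k => hi (by rw [h]; exact hkA))]; ring
    · show ∑ i, (1 - ε)⁻¹ * (q.1 i - ε * (if i = k then (1 : ℝ) else 0)) = 1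
      rw [← Finset.mul_sum, Finset.sum_sub_distrib, hsum, ← Finset.mul_sum]
      simp only [Finset.sum_ite_eq', Finset.mem_univ, if_true, mul_one]
      exact inv_mul_cancel₀ h1ε.ne'
    · intro i
      show -((1 - ε)⁻¹ * (q.1 i - ε * (if i = k then (1 : ℝ) else 0)) * β i)
        + (1 - ε)⁻¹ * (q.2 i.castSucc - ε * delrk β k r i.castSucc)
        - (1 - ε)⁻¹ * (q.2 i.succ - ε * delrk β k r i.succ) ≤ 0
      have key : 0 ≤ (q.1 i * β i - q.2 i.castSucc + q.2 i.succ)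
          - ε * (if (i : ℕ) + 1 = r then β k else 0) := by
        by_cases h : (i : ℕ) + 1 = r
        · rw [if_pos h]
          linarith [hε3 i (hU i h)]
        · rw [if_neg h]
          linarith [hsl i]
      rw [← hdU i] at key
      have := mul_nonneg hinv.le key
      linarith
  have hpq : p = q := by
    apply hext p hpS _ hq'S
    refine ⟨ε, 1 - ε, he, h1ε, by ring, ?_⟩
    rw [smul_smul, mul_inv_cancel₀ h1ε.ne', one_smul]
    abel
  exact ⟨by rw [← hpq], by rw [← hpq]⟩
end
end

section
/- Let x ∈ G, I = I(x), B = B(x), A = A(x), and fix k ∈ A. With s and t as defined (s the largest j ≤ k with j ∉ I, s = 0 if none; t the least j ∈ {k+1,…,J} with j ∉ B, t = J+1 if none) and δ^{(r,k)}_i = β_k(1_{i ≥ r+1} − 1_{i ≥ k+1}): (i) if r = 0 then h(e_k, δ^{(r,k)}) = c > 0; (ii) if r ≥ 1 then h(e_k, δ^{(r,k)}) = c + λ(1 − e^{β_k}) + μ_r(1 − e^{−β_k}); and (iii) for every r with s ≤ r ≤ t−1, h(e_k, δ^{(r,k)}) ≥ 0. -/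
open Real

noncomputable section

/-- Value of `h` at `(e_k, δ^{(r,k)})`, all `r`. -/
theorem hFun_delrk_aux (J : ℕ) [NeZero J] (lam c : ℝ) (μ β : Fin J → ℝ) (k : Fin J) (r : ℕ) :
    hFun lam c μ β ((fun i => if i = k then (1 : ℝ) else 0), delrk β k r) =
      c + lam * (1 - Real.exp (if r = 0 then 0 else β k)) +
        ∑ i : Fin J, if (i : ℕ) + 1 = r then μ i * (1 - Real.exp (-(β k))) else 0 := by
  have h1 : (∑ i, (if i = k then (1 : ℝ) else 0) * β i) - delrk β k r 0
      = if r = 0 then 0 else β k := by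
    simp only [delrk, ite_mul, one_mul, zero_mul, Finset.sum_ite_eq', Finset.mem_univ, if_true]
    by_cases hr : r = 0 <;> simp [hr]
  unfold hFun
  simp only
  rw [h1]
  congr 1
  apply Finset.sum_congr rfl
  intro i _
  have h2 : -((if i = k then (1 : ℝ) else 0) * β i) + delrk β k r i.castSucc - delrk β k r i.succ
      = if (i : ℕ) + 1 = r then -(β k) else 0 := by
    have e1 : ((if r ≤ (i : ℕ) then 1 else 0) - (if r ≤ (i : ℕ) + 1 then 1 else 0) : ℝ)
        = if (i : ℕ) + 1 = r then -1 else 0 := by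
      split_ifs <;> first | omega | norm_num
    have e2 : ((if (k : ℕ) + 1 ≤ (i : ℕ) then 1 else 0)
        - (if (k : ℕ) + 1 ≤ (i : ℕ) + 1 then 1 else 0) : ℝ)
        = if i = k then -1 else 0 := by
      simp only [Fin.ext_iff]
      split_ifs <;> first | omega | norm_num
    have e3 : (if i = k then (1 : ℝ) else 0) * β i = (if i = k then (1 : ℝ) else 0) * β k := by
      by_cases h : i = k <;> simp [h]
    have e4 : (if i = k then (-1 : ℝ) else 0) = -(if i = k then (1 : ℝ) else 0) := by
      split_ifs <;> simp
    have e5 : (if (i : ℕ) + 1 = r then -(β k) else 0)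
        = β k * (if (i : ℕ) + 1 = r then -1 else 0) := by
      split_ifs <;> simp
    rw [e4] at e2
    rw [e3, e5, ← e1]
    simp only [delrk, Fin.val_castSucc, Fin.val_succ]
    linear_combination (-(β k)) * e2
  rw [h2]
  split_ifs <;> simp

theorem hFun_delrk_pos (J : ℕ) [NeZero J] (lam c : ℝ) (μ β : Fin J → ℝ) (k : Fin J) (r : ℕ)
    (h1 : 1 ≤ r) (hr : r - 1 < J) :
    hFun lam c μ β ((fun i => if i = k then (1 : ℝ) else 0), delrk β k r) =
        c + lam * (1 - Real.exp (β k)) + μ ⟨r - 1, hr⟩ * (1 - Real.exp (-(β k))) := by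
  rw [hFun_delrk_aux, if_neg (by omega)]
  congr 1
  rw [Finset.sum_eq_single (⟨r - 1, hr⟩ : Fin J)]
  · rw [if_pos]
    simp only
    omega
  · intro b _ hb
    rw [if_neg]
    intro h
    apply hb
    apply Fin.ext
    simp only
    omega
  · simp

/-- values of `h` at the extreme points `(e_k, δ^{(r,k)})`:
(i) `r = 0` gives `c > 0`; (ii) `r ≥ 1` gives `c + λ(1−e^{β_k}) + μ_r(1−e^{−β_k})`;
(iii) for `s ≤ r ≤ t−1` the value is nonnegative. -/
theorem stmt15 (J : ℕ) [NeZero J] (lam c : ℝ) (μ z β : Fin J → ℝ)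
    (hlam : 0 < lam) (hc : 0 < c) (hμ : ∀ i, 0 < μ i) (hz : ∀ i, 0 < z i)
    (hβ : ∀ i, 0 < β i ∧
      c + lam * (1 - Real.exp (β i)) + μ i * (1 - Real.exp (-(β i))) = 0)
    (x : Fin J → ℝ) (hx : x ∈ domG z) (k : Fin J) (hk : k ∈ Aset μ z x) :
    (hFun lam c μ β ((fun i => if i = k then (1 : ℝ) else 0), delrk β k 0) = c ∧ 0 < c) ∧
    (∀ r : ℕ, 1 ≤ r → ∀ hr : r - 1 < J,
      hFun lam c μ β ((fun i => if i = k then (1 : ℝ) else 0), delrk β k r) =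
        c + lam * (1 - Real.exp (β k)) + μ ⟨r - 1, hr⟩ * (1 - Real.exp (-(β k)))) ∧
    (∀ r : ℕ, sIdx x k ≤ r → r + 1 ≤ tIdx z x k →
      0 ≤ hFun lam c μ β ((fun i => if i = k then (1 : ℝ) else 0), delrk β k r)) := by
  have h0 : hFun lam c μ β ((fun i => if i = k then (1 : ℝ) else 0), delrk β k 0) = c := by
    rw [hFun_delrk_aux]
    simp
  refine ⟨⟨h0, hc⟩, fun r h1 hr => hFun_delrk_pos J lam c μ β k r h1 hr, ?_⟩
  intro r _ hrt
  rcases Nat.eq_zero_or_pos r with rfl | hpos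
  · rw [h0]
    exact hc.le
  have hJ : r + 1 ≤ J + 1 := hrt.trans (Nat.sInf_le (Set.mem_insert _ _))
  have hr : r - 1 < J := by omega
  rw [hFun_delrk_pos J lam c μ β k r hpos hr]
  have hbox : ∀ j : Fin J, k < j → (j : ℕ) + 1 ≤ r → x j = z j := by
    intro j hkj hj
    by_contra hne
    have : tIdx z x k ≤ (j : ℕ) + 1 :=
      Nat.sInf_le (Set.mem_insert_of_mem _ ⟨j, ⟨hkj, hne⟩, rfl⟩)
    omega
  have hmu : μ k ≤ μ ⟨r - 1, hr⟩ := by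
    rcases lt_trichotomy (⟨r - 1, hr⟩ : Fin J) k with h | h | h
    · exact hk.1 _ h
    · rw [h]
    · have hlt : (k : ℕ) < r - 1 := h
      rcases hk.2 with h2 | h2
      · exfalso
        have hk1 : (k : ℕ) + 1 < J := by omega
        refine h2 hk1 (hbox _ ?_ ?_)
        · exact Nat.lt_succ_self (k : ℕ)
        · simp only
          omega
      · refine (h2 _ h ?_).le
        intro j hkj hj
        have hj' : (j : ℕ) ≤ r - 1 := hj
        exact hbox j hkj (by omega)
  have hexp : 0 ≤ 1 - Real.exp (-(β k)) := by
    have : Real.exp (-(β k)) ≤ 1 := Real.exp_le_one_iff.mpr (by linarith [(hβ k).1])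
    linarith
  have := mul_le_mul_of_nonneg_right hmu hexp
  linarith [(hβ k).2]
end
end
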